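/- For every m≥7, D((t_{m+1}+t_{m-1}−3)/2) − D((t_m+t_{m-2}−3)/2) = (m/22)(7t_m−13t_{m-1}+t_{m-2}) + (1/44)(−41t_m+74t_{m-1}−7t_{m-2}) + 1/4. -/

import Mathlib

/-- The three-letter alphabet of the Tribonacci word. -/
inductive TLetter : Type
  | a | b | c
deriving DecidableEq

/-- The Tribonacci substitution σ(a)=ab, σ(b)=ac, σ(c)=a. -/
def tsubst : TLetter → List TLetter
  | .a => [.a, .b]
  | .b => [.a, .c]
  | .c => [.a]

/-- `Tword m = σ^m(a)`, the m-th finite Tribonacci word. -/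
def Tword : ℕ → List TLetter
  | 0 => [.a]
  | n + 1 => (Tword n).flatMap tsubst

/-- The prefix 𝕋[1,n] of the Tribonacci word of length n
(each `Tword n` is a prefix of the next and has length ≥ n). -/
def TPrefix (n : ℕ) : List TLetter := (Tword n).take n

/-- A word is a factor of the Tribonacci word 𝕋. -/
def IsFactorT (w : List TLetter) : Prop := ∃ m, w <:+: Tword m

/-- `tribAux i = t_{i-2}`: Tribonacci numbers, shifted so that the index is a natural. -/
def tribAux : ℕ → ℕ
  | 0 => 0
  | 1 => 1
  | 2 => 1
  | n + 3 => tribAux (n + 2) + tribAux (n + 1) + tribAux n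

/-- The Tribonacci numbers `t m` for `m : ℤ`: t₋₂=0, t₋₁=1, t₀=1,
`t m = t (m-1) + t (m-2) + t (m-3)` for m ≥ 1. (Junk value 0 below -2.) -/
def t (m : ℤ) : ℕ := tribAux (m + 2).toNat

/-- Kernel numbers: k₀=0, k₁=k₂=1, `k m = k (m-1) + k (m-2) + k (m-3) - 1` for m ≥ 3. -/
def kAux : ℕ → ℕ
  | 0 => 0
  | 1 => 1
  | 2 => 1
  | n + 3 => kAux (n + 2) + kAux (n + 1) + kAux n - 1

def kker (m : ℤ) : ℕ := kAux m.toNat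

/-- `A n`: the number of distinct nonempty words w with ww a factor of 𝕋[1,n]. -/
noncomputable def A (n : ℕ) : ℕ := Nat.card {w : List TLetter // w ≠ [] ∧ (w ++ w) <:+: TPrefix n}

/-- `B n`: the number of occurrences of squares in 𝕋[1,n], i.e. of pairs (w,i) with
w nonempty, i ≥ 1, ww occurring in 𝕋 at position i and i + 2|w| - 1 ≤ n. -/
noncomputable def B (n : ℕ) : ℕ :=
  Nat.card {p : List TLetter × ℕ // p.1 ≠ [] ∧ 1 ≤ p.2 ∧
    p.2 + 2 * p.1.length - 1 ≤ n ∧ (p.1 ++ p.1) <+: (TPrefix n).drop (p.2 - 1)}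

/-- `C n`: the number of distinct nonempty words w with www a factor of 𝕋[1,n]. -/
noncomputable def C (n : ℕ) : ℕ := Nat.card {w : List TLetter // w ≠ [] ∧ (w ++ w ++ w) <:+: TPrefix n}

/-- `D n`: the number of occurrences of cubes in 𝕋[1,n], i.e. of pairs (w,i) with
w nonempty, i ≥ 1, www occurring in 𝕋 at position i and i + 3|w| - 1 ≤ n. -/
noncomputable def D (n : ℕ) : ℕ :=
  Nat.card {p : List TLetter × ℕ // p.1 ≠ [] ∧ 1 ≤ p.2 ∧
    p.2 + 3 * p.1.length - 1 ≤ n ∧ (p.1 ++ p.1 ++ p.1) <+: (TPrefix n).drop (p.2 - 1)}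

lemma Tword_prefix_succ (m : ℕ) : Tword m <+: Tword (m + 1) := by
  induction m with
  | zero => exact ⟨[.b], rfl⟩
  | succ m ih =>
    obtain ⟨v, hv⟩ := ih
    refine ⟨v.flatMap tsubst, ?_⟩
    change (Tword m).flatMap tsubst ++ _ = (Tword (m + 1)).flatMap tsubst
    rw [← hv, List.flatMap_append]

lemma Tword_prefix_of_le {m n : ℕ} (h : m ≤ n) : Tword m <+: Tword n := by
  induction n, h using Nat.le_induction with
  | base => exact List.prefix_rfl
  | succ n _ ih => exact ih.trans (Tword_prefix_succ n)

lemma length_le_length_flatMap_tsubst (l : List TLetter) :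
    l.length ≤ (l.flatMap tsubst).length := by
  induction l with
  | nil => simp
  | cons x l ih =>
    have : 1 ≤ (tsubst x).length := by cases x <;> simp [tsubst]
    simp only [List.flatMap_cons, List.length_append, List.length_cons]
    omega

lemma lt_length_Tword (m : ℕ) : m < (Tword m).length := by
  suffices h : ∃ v, Tword m = .a :: v ∧ m ≤ v.length by
    obtain ⟨v, hv, hm⟩ := h
    rw [hv, List.length_cons]
    omega
  induction m with
  | zero => exact ⟨[], rfl, le_rfl⟩
  | succ m ih =>
    obtain ⟨v, hv, hm⟩ := ih
    refine ⟨.b :: v.flatMap tsubst, ?_, ?_⟩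
    · change (Tword m).flatMap tsubst = _
      rw [hv]
      rfl
    · have := length_le_length_flatMap_tsubst v
      rw [List.length_cons]
      omega

/-- The Tribonacci word as a sequence, indexed from `0`. -/
def tri (i : ℕ) : TLetter := (Tword i)[i]'(lt_length_Tword i)

/-- The factor of the Tribonacci word of length `n` that starts at position `x`. -/
def triSlice (x n : ℕ) : List TLetter := (List.range n).map fun j => tri (x + j)

@[simp] lemma length_triSlice (x n : ℕ) : (triSlice x n).length = n := by simp [triSlice]

lemma getElem_Tword (m i : ℕ) (h : i < (Tword m).length) : (Tword m)[i] = tri i := by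
  rcases le_total m i with hmi | hmi
  · exact (Tword_prefix_of_le hmi).getElem h
  · exact ((Tword_prefix_of_le hmi).getElem (lt_length_Tword i)).symm

lemma take_Tword (m n : ℕ) (h : n ≤ (Tword m).length) : (Tword m).take n = triSlice 0 n := by
  apply List.ext_getElem
  · simpa using h
  · intro i h1 h2
    simp [triSlice, getElem_Tword]

lemma TPrefix_eq_triSlice (n : ℕ) : TPrefix n = triSlice 0 n :=
  take_Tword n n (lt_length_Tword n).le

lemma triSlice_add (x m n : ℕ) : triSlice x (m + n) = triSlice x m ++ triSlice (x + m) n := by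
  simp [triSlice, List.range_add, add_assoc]

lemma triSlice_inj {x y n : ℕ} :
    triSlice x n = triSlice y n ↔ ∀ j < n, tri (x + j) = tri (y + j) := by
  simp [triSlice, List.map_inj_left]

lemma prefix_triSlice {u : List TLetter} {x n : ℕ} :
    u <+: triSlice x n ↔ u.length ≤ n ∧ u = triSlice x u.length := by
  constructor
  · intro h
    have hl : u.length ≤ n := by simpa using h.length_le
    refine ⟨hl, ?_⟩
    obtain ⟨k, rfl⟩ := Nat.exists_eq_add_of_le hl
    rw [triSlice_add] at h
    exact (List.prefix_append_right_inj []).1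
      (by simpa using (List.prefix_of_prefix_length_le h (List.prefix_append _ _)
        (by simp))) |>.eq_of_length (by simp)
  · rintro ⟨hl, hu⟩
    obtain ⟨k, rfl⟩ := Nat.exists_eq_add_of_le hl
    rw [triSlice_add, ← hu]
    exact List.prefix_append _ _

lemma drop_triSlice (x n : ℕ) : (triSlice 0 n).drop x = triSlice x (n - x) := by
  apply List.ext_getElem
  · simp
  · intro i h1 h2
    simp [triSlice]

/-- The length of the image under the substitution of the prefix of length `n`. -/
def triLen (n : ℕ) : ℕ := ((triSlice 0 n).flatMap tsubst).length

lemma flatMap_triSlice (n : ℕ) : (triSlice 0 n).flatMap tsubst = triSlice 0 (triLen n) := by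
  have h1 : triSlice 0 n <+: Tword n := by
    rw [← TPrefix_eq_triSlice]
    exact List.take_prefix _ _
  obtain ⟨v, hv⟩ := h1
  have h2 : (triSlice 0 n).flatMap tsubst <+: Tword (n + 1) :=
    ⟨v.flatMap tsubst, by rw [← List.flatMap_append, hv]; rfl⟩
  rw [List.prefix_iff_eq_take.1 h2]
  exact take_Tword _ _ h2.length_le

lemma triSlice_triLen (n : ℕ) : triLen (n + 1) = triLen n + (tsubst (tri n)).length ∧
    triSlice (triLen n) (tsubst (tri n)).length = tsubst (tri n) := by
  have h0 : triSlice 0 (n + 1) = triSlice 0 n ++ [tri n] := by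
    rw [triSlice_add]
    simp [triSlice]
  have h1 : triLen (n + 1) = triLen n + (tsubst (tri n)).length := by
    simp [triLen, h0]
  refine ⟨h1, ?_⟩
  have h2 := flatMap_triSlice (n + 1)
  rw [h0, List.flatMap_append, flatMap_triSlice, h1, triSlice_add] at h2
  simpa using (List.append_cancel_left h2).symm

/-- The cyclic permutation of the letters, with `σ(x)a` starting with `a · rot x`. -/
def TLetter.rot : TLetter → TLetter
  | .a => .b
  | .b => .c
  | .c => .a

lemma TLetter.rot_injective : Function.Injective TLetter.rot := by
  intro x y h
  cases x <;> cases y <;> simp_all [TLetter.rot]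

lemma triLen_zero : triLen 0 = 0 := rfl

lemma triLen_succ (n : ℕ) : triLen (n + 1) = triLen n + (tsubst (tri n)).length :=
  (triSlice_triLen n).1

lemma tri_triLen (n : ℕ) : tri (triLen n) = .a := by
  have h := (triSlice_triLen n).2
  cases hn : tri n <;> simp [hn, tsubst, triSlice, List.range_succ] at h <;> simp_all

lemma tri_triLen_add_one (n : ℕ) : tri (triLen n + 1) = (tri n).rot := by
  have h := (triSlice_triLen n).2
  cases hn : tri n
  · simp_all [tsubst, triSlice, List.range_succ, TLetter.rot]
  · simp_all [tsubst, triSlice, List.range_succ, TLetter.rot]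
  · have h1 := triLen_succ n
    rw [hn] at h1
    exact h1 ▸ tri_triLen (n + 1)

lemma triLen_succ_cases (n : ℕ) :
    (tri n = .c ∧ triLen (n + 1) = triLen n + 1) ∨
    (tri n ≠ .c ∧ triLen (n + 1) = triLen n + 2) := by
  have h := triLen_succ n
  cases hn : tri n <;> simp_all [tsubst]

lemma tri_triLen_succ_sub_one (n : ℕ) : tri (triLen (n + 1) - 1) = (tri n).rot := by
  rcases triLen_succ_cases n with ⟨h, h'⟩ | ⟨h, h'⟩
  · rw [h', Nat.add_sub_cancel, tri_triLen, h]
    rfl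
  · rw [h']
    exact tri_triLen_add_one n

lemma triLen_strictMono : StrictMono triLen := by
  apply strictMono_nat_of_lt_succ
  intro n
  rcases triLen_succ_cases n with h | h <;> omega

lemma exists_triLen (i : ℕ) :
    ∃ n, i = triLen n ∨ (i = triLen n + 1 ∧ triLen (n + 1) = i + 1) := by
  induction i with
  | zero => exact ⟨0, Or.inl rfl⟩
  | succ i ih =>
    obtain ⟨n, h | h⟩ := ih
    · rcases triLen_succ_cases n with h' | h'
      · exact ⟨n + 1, Or.inl (by omega)⟩
      · exact ⟨n, Or.inr (by omega)⟩
    · exact ⟨n + 1, Or.inl h.2.symm⟩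

lemma eq_triLen_of_tri_eq_a {i : ℕ} (h : tri i = .a) : ∃ n, i = triLen n := by
  obtain ⟨n, hn | ⟨hn, hn'⟩⟩ := exists_triLen i
  · exact ⟨n, hn⟩
  · rcases triLen_succ_cases n with ⟨hc, h'⟩ | ⟨hc, h'⟩
    · omega
    · rw [hn, tri_triLen_add_one] at h
      cases hx : tri n <;> simp_all [TLetter.rot]

lemma tri_sub_one_of_ne_a {i : ℕ} (h : tri i ≠ .a) : 1 ≤ i ∧ tri (i - 1) = .a := by
  obtain ⟨n, rfl | ⟨rfl, -⟩⟩ := exists_triLen i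
  · exact absurd (tri_triLen n) h
  · exact ⟨by omega, tri_triLen n⟩

lemma tri_succ_of_ne_a {i : ℕ} (h : tri i ≠ .a) : tri (i + 1) = .a := by
  by_contra h'
  exact h (tri_sub_one_of_ne_a h').2

lemma triLen_add_le (n j : ℕ) : triLen n + j ≤ triLen (n + j) := by
  induction j with
  | zero => rfl
  | succ j ih =>
    have := triLen_strictMono (show n + j < n + (j + 1) by omega)
    omega

lemma not_eventually_periodic (p : ℕ) (hp : 1 ≤ p) (s : ℕ) :
    ∃ i, s ≤ i ∧ tri i ≠ tri (i + p) := by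
  induction p using Nat.strong_induction_on generalizing s with
  | _ p ih =>
    by_contra! hper
    have hs : s ≤ triLen (triLen s) :=
      (triLen_strictMono.le_apply).trans triLen_strictMono.le_apply
    set n := triLen s with hn
    obtain ⟨n', hn'⟩ := eq_triLen_of_tri_eq_a ((hper _ hs).symm.trans (tri_triLen n))
    have hlt : n < n' := triLen_strictMono.lt_iff_lt.1 (by omega)
    obtain ⟨q, rfl⟩ := Nat.exists_eq_add_of_le hlt.le
    have key : ∀ i, triLen (n + i + q) = triLen (n + i) + p ∧ tri (n + i) = tri (n + i + q) := by
      have step : ∀ i, triLen (n + i + q) = triLen (n + i) + p →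
          tri (n + i) = tri (n + i + q) := by
        intro i hi
        apply TLetter.rot_injective
        have hle : triLen n ≤ triLen (n + i) := triLen_strictMono.monotone (by omega)
        rw [← tri_triLen_add_one, ← tri_triLen_add_one, hi, hper _ (by omega)]
        congr 1
        omega
      intro i
      induction i with
      | zero => exact ⟨hn'.symm, step 0 hn'.symm⟩
      | succ i ihi =>
        have h1 : triLen (n + (i + 1) + q) = triLen (n + (i + 1)) + p := by
          rw [show n + (i + 1) + q = n + i + q + 1 by omega, ← add_assoc n i 1,
            triLen_succ, triLen_succ, ← ihi.2]
          omega
        exact ⟨h1, step _ h1⟩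
    have hqp : q < p := by
      have h1 : triLen (n + 1) = triLen n + 2 := by
        rcases triLen_succ_cases n with h | h
        · rw [hn, tri_triLen] at h
          simp at h
        · exact h.2
      have h2 := triLen_add_le (n + 1) (q - 1)
      rw [show n + 1 + (q - 1) = n + q by omega] at h2
      omega
    obtain ⟨i, hi, hne⟩ := ih q hqp (by omega) n
    obtain ⟨j, rfl⟩ := Nat.exists_eq_add_of_le hi
    exact hne (key j).2

/-- The lengths of the palindromic prefixes `R_{k+1} = σ(R_k)a` of the Tribonacci word. -/
def palLen : ℕ → ℕ
  | 0 => 0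
  | k + 1 => triLen (palLen k) + 1

lemma triLen_add_of_prefix {x L : ℕ} (h : ∀ i < L, tri (x + i) = tri i) :
    triLen (x + L) = triLen x + triLen L := by
  induction L with
  | zero => simp [triLen_zero]
  | succ L ih =>
    rw [← add_assoc, triLen_succ, triLen_succ, ih fun i hi => h i (by omega), h L (by omega)]
    omega

lemma tri_iterate_add (k x i : ℕ) (hi : i < palLen k) : tri (triLen^[k] x + i) = tri i := by
  induction k generalizing i with
  | zero => simp [palLen] at hi
  | succ k ih =>
    rw [Function.iterate_succ_apply']
    set y := triLen^[k] x
    have hadd : ∀ j ≤ palLen k, triLen (y + j) = triLen y + triLen j := fun j hj =>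
      triLen_add_of_prefix fun i hi => ih i (by omega)
    have hi' : i ≤ triLen (palLen k) := by
      simp only [palLen] at hi
      omega
    obtain ⟨n, hn | ⟨hn, hn'⟩⟩ := exists_triLen i
    · have hle : n ≤ palLen k := triLen_strictMono.le_iff_le.1 (by omega)
      rw [hn, ← hadd n hle, tri_triLen, tri_triLen]
    · have hlt : n < palLen k := triLen_strictMono.lt_iff_lt.1 (by omega)
      rw [hn, ← add_assoc, ← hadd n hlt.le, tri_triLen_add_one, tri_triLen_add_one, ih n hlt]

lemma triLen_iterate_add_palLen (k x : ℕ) :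
    triLen (triLen^[k] x + palLen k) = triLen^[k + 1] x + triLen (palLen k) := by
  rw [triLen_add_of_prefix fun i hi => tri_iterate_add k x i hi, Function.iterate_succ_apply']

lemma palLen_add (k j : ℕ) : palLen (k + j) = triLen^[k] (palLen j) + palLen k := by
  induction k with
  | zero => simp [palLen]
  | succ k ih =>
    rw [show k + 1 + j = k + j + 1 by omega]
    simp only [palLen]
    rw [ih, triLen_iterate_add_palLen]
    omega

/-- The length of `σ^k(x)`. -/
def imgLen (k : ℕ) : TLetter → ℕ
  | .a => tribAux (k + 2)
  | .b => tribAux (k + 1) + tribAux k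
  | .c => tribAux (k + 1)

lemma iterate_triLen_succ (k n : ℕ) :
    triLen^[k] (n + 1) = triLen^[k] n + imgLen k (tri n) := by
  induction k generalizing n with
  | zero => cases hn : tri n <;> simp [imgLen, tribAux]
  | succ k ih =>
    rw [Function.iterate_succ_apply, Function.iterate_succ_apply]
    have h0 := ih (triLen n)
    have h1 := ih (triLen n + 1)
    rw [tri_triLen] at h0
    rw [tri_triLen_add_one] at h1
    have hT : tribAux (k + 1 + 2) = tribAux (k + 2) + tribAux (k + 1) + tribAux k := rfl
    have hT' : tribAux (k + 1 + 1) = tribAux (k + 2) := rfl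
    have h2 := triLen_succ n
    cases hn : tri n <;> rw [hn] at h1 h2
    · rw [show triLen (n + 1) = triLen n + 1 + 1 from h2]
      simp only [imgLen, TLetter.rot] at h0 h1 ⊢
      omega
    · rw [show triLen (n + 1) = triLen n + 1 + 1 from h2]
      simp only [imgLen, TLetter.rot] at h0 h1 ⊢
      omega
    · rw [show triLen (n + 1) = triLen n + 1 from h2]
      simp only [imgLen] at h0 ⊢
      omega

lemma tri_zero : tri 0 = .a := rfl

lemma palLen_succ (k : ℕ) : palLen (k + 1) = palLen k + tribAux (k + 2) := by
  have h0 : triLen^[k] 0 = 0 := Function.iterate_fixed triLen_zero k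
  have h1 := iterate_triLen_succ k 0
  rw [tri_zero, h0] at h1
  have h2 := palLen_add k 1
  simp only [palLen, triLen_zero, zero_add, imgLen] at h1 h2 ⊢
  rw [h2, h1]
  omega

lemma two_mul_palLen (k : ℕ) : 2 * palLen k + 3 = tribAux (k + 3) + tribAux (k + 1) := by
  induction k with
  | zero => rfl
  | succ k ih =>
    have h1 : tribAux (k + 1 + 3) = tribAux (k + 3) + tribAux (k + 2) + tribAux (k + 1) := rfl
    rw [palLen_succ, h1, show k + 1 + 1 = k + 2 from rfl]
    omega

lemma tribAux_mono : Monotone tribAux := by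
  apply monotone_nat_of_le_succ
  intro n
  match n with
  | 0 => decide
  | 1 => decide
  | n + 2 =>
    change _ ≤ tribAux (n + 2) + tribAux (n + 1) + tribAux n
    omega

lemma palLen_lt (k : ℕ) : palLen k < 2 * imgLen k .a ∧ palLen k < 2 * imgLen k .b ∧
    palLen k < 3 * imgLen k .c := by
  simp only [imgLen]
  have h := two_mul_palLen k
  have h1 : tribAux (k + 3) = tribAux (k + 2) + tribAux (k + 1) + tribAux k := rfl
  have h2 := tribAux_mono (show k ≤ k + 1 by omega)
  have h3 := tribAux_mono (show k + 1 ≤ k + 2 by omega)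
  have h4 : tribAux (k + 2) ≤ tribAux (k + 1) + tribAux k + tribAux k := by
    match k with
    | 0 => decide
    | 1 => decide
    | k + 2 =>
      have e1 : tribAux (k + 2 + 2) = tribAux (k + 2 + 1) + tribAux (k + 2) + tribAux (k + 1) := rfl
      have e2 : tribAux (k + 2 + 1) = tribAux (k + 2) + tribAux (k + 1) + tribAux k := rfl
      have e3 := tribAux_mono (show k + 1 ≤ k + 2 by omega)
      omega
  omega

/-- A maximal factor with period `p`: the letters at distance `p` agree exactly on the
positions of the interval `[s, s + L)`, and disagree just before and just after it. -/
structure IsMaxRun (p s L : ℕ) : Prop where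
  eq : ∀ i < L, tri (s + i) = tri (s + i + p)
  right : tri (s + L) ≠ tri (s + L + p)
  left : s = 0 ∨ tri (s - 1) ≠ tri (s - 1 + p)

lemma IsMaxRun.desubstitute {p s L : ℕ} (h : IsMaxRun p s L) (hp : 1 ≤ p) (hL : 1 ≤ L) :
    ∃ q n L', 1 ≤ q ∧ s = triLen n ∧ s + p = triLen (n + q) ∧
      s + L = triLen (n + L') + 1 ∧ IsMaxRun q n L' := by
  have hs : tri s = .a := by
    by_contra hne
    obtain ⟨h1, h2⟩ := tri_sub_one_of_ne_a hne
    have hne' : tri (s + p) ≠ .a := by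
      have := h.eq 0 hL
      rw [add_zero] at this
      rwa [← this]
    have h3 := (tri_sub_one_of_ne_a hne').2
    rcases h.left with h4 | h4
    · omega
    · exact h4 (by rw [h2, show s - 1 + p = s + p - 1 by omega, h3])
  have hend : tri (s + L - 1) = .a := by
    by_contra hne
    have h1 := tri_succ_of_ne_a hne
    have h2 := h.eq (L - 1) (by omega)
    rw [show s + (L - 1) = s + L - 1 by omega] at h2
    rw [h2] at hne
    have h3 := tri_succ_of_ne_a hne
    apply h.right
    rw [show s + L = s + L - 1 + 1 by omega, h1,
      show s + L - 1 + 1 + p = s + L - 1 + p + 1 by omega, h3]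
  have hsp : tri (s + p) = .a := by
    rw [← hs]
    exact (h.eq 0 hL).symm
  obtain ⟨n, rfl⟩ := eq_triLen_of_tri_eq_a hs
  obtain ⟨n', hn'⟩ := eq_triLen_of_tri_eq_a hsp
  obtain ⟨x, hx⟩ := eq_triLen_of_tri_eq_a hend
  have hlt : n < n' := triLen_strictMono.lt_iff_lt.1 (by omega)
  have hle : n ≤ x := triLen_strictMono.le_iff_le.1 (by omega)
  obtain ⟨q, rfl⟩ := Nat.exists_eq_add_of_le hlt.le
  obtain ⟨L', rfl⟩ := Nat.exists_eq_add_of_le hle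
  have heq : ∀ i < L', triLen (n + i + q) = triLen (n + i) + p →
      tri (n + i) = tri (n + i + q) := by
    intro i hi hpi
    apply TLetter.rot_injective
    have h1 : triLen n ≤ triLen (n + i) := triLen_strictMono.monotone (by omega)
    have h2 : triLen (n + i) < triLen (n + L') := triLen_strictMono (by omega)
    have h3 := h.eq (triLen (n + i) + 1 - triLen n) (by omega)
    rw [show triLen n + (triLen (n + i) + 1 - triLen n) = triLen (n + i) + 1 by omega] at h3
    rw [← tri_triLen_add_one, ← tri_triLen_add_one, hpi, h3]
    congr 1
    omega
  have hper : ∀ i ≤ L', triLen (n + i + q) = triLen (n + i) + p := by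
    intro i hi
    induction i with
    | zero => exact hn'.symm
    | succ i ih =>
      have h1 := ih (by omega)
      rw [show n + (i + 1) + q = n + i + q + 1 by omega, ← add_assoc n i 1, triLen_succ,
        triLen_succ, ← heq i (by omega) h1]
      omega
  refine ⟨q, n, L', by omega, rfl, hn', by omega, fun i hi => heq i hi (hper i hi.le), ?_, ?_⟩
  · intro hc
    apply h.right
    have h1 := congrArg TLetter.rot hc
    rw [← tri_triLen_add_one, ← tri_triLen_add_one, hper L' le_rfl] at h1
    rw [show triLen n + L = triLen (n + L') + 1 by omega, h1]
    congr 1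
    omega
  · rcases Nat.eq_zero_or_pos n with h0 | h0
    · exact Or.inl h0
    · right
      intro hc
      have hpos : 1 ≤ triLen n := h0.trans_le triLen_strictMono.le_apply
      rcases h.left with h1 | h1
      · omega
      · apply h1
        rw [show triLen n - 1 + p = triLen (n + q) - 1 by omega]
        have e1 := tri_triLen_succ_sub_one (n - 1)
        have e2 := tri_triLen_succ_sub_one (n - 1 + q)
        rw [show n - 1 + 1 = n by omega] at e1
        rw [show n - 1 + q + 1 = n + q by omega] at e2
        rw [e1, e2, hc]

lemma IsMaxRun.exists_iterate {p s L : ℕ} (h : IsMaxRun p s L) (hp : 1 ≤ p) :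
    ∃ k n q, 1 ≤ q ∧ s = triLen^[k] n ∧ s + p = triLen^[k] (n + q) ∧ L = palLen k := by
  induction L using Nat.strong_induction_on generalizing p s with
  | _ L ih =>
    rcases Nat.eq_zero_or_pos L with h0 | h0
    · exact ⟨0, s, p, hp, rfl, rfl, h0⟩
    · obtain ⟨q, n, L', hq, hs, hsp, hsL, h'⟩ := h.desubstitute hp h0
      have hlt := triLen_add_le n L'
      obtain ⟨k, n₀, q₀, hq₀, hn, hnq, hL'⟩ := ih L' (by omega) h' hq
      refine ⟨k + 1, n₀, q₀, hq₀, ?_, ?_, ?_⟩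
      · rw [Function.iterate_succ_apply', ← hn, hs]
      · rw [Function.iterate_succ_apply', ← hnq, hsp]
      · rw [hL', hn, triLen_iterate_add_palLen, Function.iterate_succ_apply', ← hn, ← hs] at hsL
        simp only [palLen]
        omega

lemma exists_isMaxRun {p x N : ℕ} (hp : 1 ≤ p) (h : ∀ j < N, tri (x + j) = tri (x + j + p)) :
    ∃ s L, s ≤ x ∧ x + N ≤ s + L ∧ IsMaxRun p s L := by
  classical
  have hl : ∃ s, s ≤ x ∧ ∀ i, s ≤ i → i < x → tri i = tri (i + p) :=
    ⟨x, le_rfl, fun i h1 h2 => by omega⟩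
  have hr := not_eventually_periodic p hp x
  obtain ⟨hs1, hs2⟩ := Nat.find_spec hl
  obtain ⟨he1, he2⟩ := Nat.find_spec hr
  have hmin : ∀ m < Nat.find hr, x ≤ m → tri m = tri (m + p) := fun m hm hxm => by
    by_contra hne
    exact Nat.find_min hr hm ⟨hxm, hne⟩
  have hminl := fun m => Nat.find_min (H := hl) (m := m)
  generalize Nat.find hl = s at *
  generalize Nat.find hr = e at *
  have hNe : x + N ≤ e := by
    by_contra hlt
    have := h (e - x) (by omega)
    rw [show x + (e - x) = e by omega] at this
    exact he2 this
  refine ⟨s, e - s, hs1, by omega, ?_, ?_, ?_⟩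
  · intro i hi
    rcases lt_or_ge (s + i) x with h1 | h1
    · exact hs2 _ (by omega) h1
    · exact hmin _ (by omega) h1
  · rwa [show s + (e - s) = e by omega]
  · by_contra! hc
    obtain ⟨h0, hc⟩ := hc
    refine hminl (s - 1) (by omega) ⟨by omega, fun i h1 h2 => ?_⟩
    rcases eq_or_lt_of_le h1 with rfl | h3
    · exact hc
    · exact hs2 i (by omega) h2

lemma iterate_triLen_strictMono (k : ℕ) : StrictMono triLen^[k] :=
  triLen_strictMono.iterate k

/-- The cubes in the Tribonacci word are those inside the images under `σ^k` of the words
`c R`, where `R` is the palindromic prefix of length `palLen k`. -/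
lemma cube_iff {p x : ℕ} :
    (1 ≤ p ∧ ∀ j < 2 * p, tri (x + j) = tri (x + j + p)) ↔
    ∃ k n i, tri n = .c ∧ p = imgLen k .c ∧ x = triLen^[k] n + i ∧ i + 2 * p ≤ palLen k := by
  constructor
  · rintro ⟨hp, h⟩
    obtain ⟨s, L, hsx, hxL, hrun⟩ := exists_isMaxRun hp h
    obtain ⟨k, n, q, hq, rfl, hsp, rfl⟩ := hrun.exists_iterate hp
    obtain ⟨ha, hb, hc⟩ := palLen_lt k
    have h1 := iterate_triLen_succ k n
    have hmono : triLen^[k] (n + 1) ≤ triLen^[k] (n + q) :=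
      (iterate_triLen_strictMono k).monotone (by omega)
    have hn : tri n = .c := by
      cases hn : tri n
      · rw [hn] at h1
        omega
      · rw [hn] at h1
        omega
      · rfl
    have hq1 : q = 1 := by
      by_contra hne
      have h2 := iterate_triLen_succ k (n + 1)
      have hmono' : triLen^[k] (n + 1 + 1) ≤ triLen^[k] (n + q) :=
        (iterate_triLen_strictMono k).monotone (by omega)
      rw [tri_succ_of_ne_a (by simp [hn])] at h2
      omega
    subst hq1
    rw [hn] at h1
    exact ⟨k, n, x - triLen^[k] n, hn, by omega, by omega, by omega⟩
  · rintro ⟨k, n, i, hn, rfl, rfl, hi⟩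
    have h1 := iterate_triLen_succ k n
    rw [hn] at h1
    refine ⟨?_, fun j hj => ?_⟩
    · have := iterate_triLen_strictMono k (show n < n + 1 by omega)
      omega
    · rw [add_assoc, tri_iterate_add k n _ (by omega),
        show triLen^[k] n + (i + j) + imgLen k .c = triLen^[k] (n + 1) + (i + j) by omega,
        tri_iterate_add k (n + 1) _ (by omega)]

lemma cube_prefix_iff {w : List TLetter} {i N : ℕ} :
    (w ≠ [] ∧ 1 ≤ i ∧ i + 3 * w.length - 1 ≤ N ∧ (w ++ w ++ w) <+: (TPrefix N).drop (i - 1)) ↔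
    ∃ x p, w = triSlice x p ∧ i = x + 1 ∧ x + 3 * p ≤ N ∧
      1 ≤ p ∧ ∀ j < 2 * p, tri (x + j) = tri (x + j + p) := by
  have hsplit : ∀ x p, triSlice x (p + p + p) =
      triSlice x p ++ triSlice (x + p) p ++ triSlice (x + (p + p)) p := by
    intro x p
    rw [triSlice_add, triSlice_add]
  constructor
  · rintro ⟨hw, hi, hN, h⟩
    obtain ⟨x, rfl⟩ := Nat.exists_eq_add_of_le' hi
    rw [TPrefix_eq_triSlice, drop_triSlice, prefix_triSlice] at h
    have h2 := h.2
    have hlen : (w ++ w ++ w).length = w.length + w.length + w.length := by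
      simp [add_assoc]
    rw [hlen, Nat.add_sub_cancel, hsplit] at h2
    obtain ⟨h3, hw3⟩ := List.append_inj' h2 (by simp)
    obtain ⟨hw1, hw2⟩ := List.append_inj' h3 (by simp)
    have e12 := triSlice_inj.1 (hw1.symm.trans hw2)
    have e23 := triSlice_inj.1 (hw2.symm.trans hw3)
    refine ⟨x, w.length, hw1, rfl, by omega, List.length_pos_of_ne_nil hw, fun j hj => ?_⟩
    rcases lt_or_ge j w.length with hlt | hge
    · rw [e12 j hlt]
      congr 1
      omega
    · obtain ⟨l, rfl⟩ := Nat.exists_eq_add_of_le hge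
      rw [← add_assoc, e23 l (by omega)]
      congr 1
      omega
  · rintro ⟨x, p, rfl, rfl, hN, hp, h⟩
    have e12 : triSlice x p = triSlice (x + p) p := triSlice_inj.2 fun j hj => by
      rw [h j (by omega)]
      congr 1
      omega
    have e23 : triSlice (x + p) p = triSlice (x + (p + p)) p := triSlice_inj.2 fun j hj => by
      rw [add_assoc, h (p + j) (by omega)]
      congr 1
      omega
    refine ⟨?_, by omega, by simp only [length_triSlice]; omega, ?_⟩
    · intro hc
      have := congrArg List.length hc
      simp at this
      omega
    · rw [TPrefix_eq_triSlice, drop_triSlice, prefix_triSlice]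
      have hlen : (triSlice x p ++ triSlice x p ++ triSlice x p).length = p + p + p := by
        simp [add_assoc]
      rw [hlen, Nat.add_sub_cancel, hsplit, ← e23, ← e12]
      exact ⟨by omega, rfl⟩

/-- The number of occurrences of a letter in the prefix of length `n`. -/
def letterCount (y : TLetter) (n : ℕ) : ℕ := ((Finset.range n).filter fun i => tri i = y).card

/-- Indices of the cubes in the palindromic prefix of length `palLen m`: the exponent `k` of the
substitution, the position of a letter `c`, and the offset of the cube in its maximal run. -/
def cubeIndex (m : ℕ) : Finset (Σ _ : ℕ, ℕ × ℕ) :=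
  (Finset.range (m + 1)).sigma fun k =>
    ((Finset.range (palLen (m - k))).filter fun i => tri i = .c) ×ˢ
      Finset.range (palLen k + 1 - 2 * imgLen k .c)

/-- The cube root and the position of the cube with the given index. -/
def cubeAt (q : Σ _ : ℕ, ℕ × ℕ) : List TLetter × ℕ :=
  (triSlice (triLen^[q.1] q.2.1 + q.2.2) (imgLen q.1 .c), triLen^[q.1] q.2.1 + q.2.2 + 1)

lemma mem_cubeIndex {m k n i : ℕ} : (⟨k, n, i⟩ : Σ _ : ℕ, ℕ × ℕ) ∈ cubeIndex m ↔
    k ≤ m ∧ n < palLen (m - k) ∧ tri n = .c ∧ i + 2 * imgLen k .c ≤ palLen k := by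
  simp only [cubeIndex, Finset.mem_sigma, Finset.mem_product, Finset.mem_filter, Finset.mem_range]
  constructor
  · rintro ⟨h1, ⟨h2, h3⟩, h4⟩
    exact ⟨by omega, h2, h3, by omega⟩
  · rintro ⟨h1, h2, h3, h4⟩
    exact ⟨by omega, ⟨h2, h3⟩, by omega⟩

lemma imgLen_c_lt {k l : ℕ} (hk : 1 ≤ k) (h : k < l) : imgLen k .c < imgLen l .c := by
  simp only [imgLen]
  refine lt_of_lt_of_le ?_ (tribAux_mono (show k + 2 ≤ l + 1 by omega))
  obtain ⟨k, rfl⟩ := Nat.exists_eq_add_of_le' hk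
  change _ < tribAux (k + 2) + tribAux (k + 1) + tribAux k
  have := tribAux_mono (show 1 ≤ k + 1 by omega)
  change 1 ≤ _ at this
  change tribAux (k + 2) < _
  omega

lemma imgLen_c_pos (k : ℕ) : 1 ≤ imgLen k .c := by
  simpa [imgLen, tribAux] using tribAux_mono (show 1 ≤ k + 1 by omega)

lemma cubeAt_injOn (m : ℕ) : Set.InjOn cubeAt (cubeIndex m) := by
  rintro ⟨k, n, i⟩ h ⟨k', n', i'⟩ h' heq
  rw [Finset.mem_coe, mem_cubeIndex] at h h'
  obtain ⟨-, -, hn, hi⟩ := h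
  obtain ⟨-, -, hn', hi'⟩ := h'
  simp only [cubeAt, Prod.mk.injEq] at heq
  have hp : imgLen k .c = imgLen k' .c := by
    simpa using congrArg List.length heq.1
  have hpos := imgLen_c_pos k
  have hk : 1 ≤ k := Nat.one_le_iff_ne_zero.2 fun h0 => by simp [h0, palLen, imgLen, tribAux] at hi
  have hk' : 1 ≤ k' :=
    Nat.one_le_iff_ne_zero.2 fun h0 => by simp [h0, palLen, imgLen, tribAux] at hi'
  obtain rfl : k = k' := by
    rcases lt_trichotomy k k' with h | h | h
    · exact absurd hp (imgLen_c_lt hk h).ne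
    · exact h
    · exact absurd hp (imgLen_c_lt hk' h).ne'
  have hlt := (palLen_lt k).2.2
  have h1 := iterate_triLen_succ k n
  have h2 := iterate_triLen_succ k n'
  rw [hn] at h1
  rw [hn'] at h2
  have hmono := (iterate_triLen_strictMono k).monotone
  obtain rfl : n = n' := by
    rcases lt_trichotomy n n' with h | h | h
    · have := hmono (show n + 1 ≤ n' from h)
      omega
    · exact h
    · have := hmono (show n' + 1 ≤ n from h)
      omega
  obtain rfl : i = i' := by omega
  rfl

lemma palLen_mono : Monotone palLen :=
  monotone_nat_of_le_succ fun k => by rw [palLen_succ]; omega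

lemma cubes_eq_image (m : ℕ) : {p : List TLetter × ℕ | p.1 ≠ [] ∧ 1 ≤ p.2 ∧
    p.2 + 3 * p.1.length - 1 ≤ palLen m ∧
      (p.1 ++ p.1 ++ p.1) <+: (TPrefix (palLen m)).drop (p.2 - 1)} =
    cubeAt '' (cubeIndex m) := by
  ext ⟨w, i⟩
  simp only [Set.mem_ofPred_eq, Set.mem_image, Finset.mem_coe]
  rw [cube_prefix_iff]
  constructor
  · rintro ⟨x, p, rfl, rfl, hN, h⟩
    obtain ⟨k, n, i, hn, rfl, rfl, hi⟩ := cube_iff.1 h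
    refine ⟨⟨k, n, i⟩, mem_cubeIndex.2 ?_, rfl⟩
    have hlt := (palLen_lt k).2.2
    have hkm : k ≤ m := by
      by_contra hc
      have := palLen_mono (show m ≤ k by omega)
      omega
    refine ⟨hkm, ?_, hn, hi⟩
    by_contra hc
    have h1 := (iterate_triLen_strictMono k).monotone (show palLen (m - k) ≤ n by omega)
    have h2 := palLen_add k (m - k)
    rw [Nat.add_sub_cancel' hkm] at h2
    omega
  · rintro ⟨⟨k, n, i'⟩, hmem, heq⟩
    obtain ⟨hkm, hlt, hn, hi⟩ := mem_cubeIndex.1 hmem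
    simp only [cubeAt, Prod.mk.injEq] at heq
    refine ⟨_, _, heq.1.symm, heq.2.symm, ?_, cube_iff.2 ⟨k, n, i', hn, rfl, rfl, hi⟩⟩
    have h1 := (iterate_triLen_strictMono k).monotone (show n + 1 ≤ palLen (m - k) from hlt)
    have h2 := palLen_add k (m - k)
    rw [Nat.add_sub_cancel' hkm] at h2
    have h3 := iterate_triLen_succ k n
    rw [hn] at h3
    omega

lemma D_palLen (m : ℕ) : D (palLen m) = ∑ k ∈ Finset.range (m + 1),
    letterCount .c (palLen (m - k)) * (palLen k + 1 - 2 * imgLen k .c) := by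
  have h : D (palLen m) = (cubeAt '' (cubeIndex m : Set (Σ _ : ℕ, ℕ × ℕ))).ncard := by
    rw [← cubes_eq_image]
    rfl
  rw [h, Set.InjOn.ncard_image (cubeAt_injOn m), Set.ncard_coe_finset, cubeIndex,
    Finset.card_sigma]
  simp [letterCount]

lemma letterCount_succ (y : TLetter) (n : ℕ) :
    letterCount y (n + 1) = letterCount y n + if tri n = y then 1 else 0 := by
  rw [letterCount, Finset.range_add_one, Finset.filter_insert]
  split_ifs with h
  · rw [Finset.card_insert_of_notMem (by simp)]
    rfl
  · rfl

lemma letterCount_triLen (n : ℕ) : letterCount .a (triLen n) = n ∧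
    letterCount .b (triLen n) = letterCount .a n ∧
    letterCount .c (triLen n) = letterCount .b n := by
  induction n with
  | zero => exact ⟨rfl, rfl, rfl⟩
  | succ n ih =>
    obtain ⟨ha, hb, hc⟩ := ih
    have h0 := tri_triLen n
    have h1 := tri_triLen_add_one n
    have h2 := triLen_succ n
    cases hn : tri n <;> rw [hn] at h1 h2
    · rw [show triLen (n + 1) = triLen n + 1 + 1 from h2]
      simp [letterCount_succ, h0, h1, hn, TLetter.rot, ha, hb, hc]
    · rw [show triLen (n + 1) = triLen n + 1 + 1 from h2]
      simp [letterCount_succ, h0, h1, hn, TLetter.rot, ha, hb, hc]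
    · rw [show triLen (n + 1) = triLen n + 1 from h2]
      simp [letterCount_succ, h0, hn, ha, hb, hc]

lemma letterCount_palLen_succ (k : ℕ) : letterCount .a (palLen (k + 1)) = palLen k + 1 ∧
    letterCount .b (palLen (k + 1)) = letterCount .a (palLen k) ∧
    letterCount .c (palLen (k + 1)) = letterCount .b (palLen k) := by
  obtain ⟨h1, h2, h3⟩ := letterCount_triLen (palLen k)
  simp [palLen, letterCount_succ, tri_triLen, h1, h2, h3]

lemma letterCount_c_palLen (k : ℕ) : letterCount .c (palLen (k + 3)) = palLen k + 1 := by
  rw [(letterCount_palLen_succ (k + 2)).2.2, (letterCount_palLen_succ (k + 1)).2.1,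
    (letterCount_palLen_succ k).1]

lemma palLen_add_three (k : ℕ) :
    palLen (k + 3) = palLen (k + 2) + palLen (k + 1) + palLen k + 3 := by
  have h0 := two_mul_palLen k
  have h1 := two_mul_palLen (k + 1)
  have h2 := two_mul_palLen (k + 2)
  have h3 := two_mul_palLen (k + 3)
  have e1 : tribAux (k + 3 + 3) = tribAux (k + 2 + 3) + tribAux (k + 1 + 3) + tribAux (k + 3) := rfl
  have e2 : tribAux (k + 3 + 1) = tribAux (k + 2 + 1) + tribAux (k + 1 + 1) + tribAux (k + 1) := rfl
  omega

lemma letterCount_c_palLen_lt_three {k : ℕ} (hk : k < 3) : letterCount .c (palLen k) = 0 := by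
  have h0 : ∀ y, letterCount y (palLen 0) = 0 := fun y => rfl
  interval_cases k
  · exact h0 _
  · rw [(letterCount_palLen_succ 0).2.2, h0]
  · rw [(letterCount_palLen_succ 1).2.2, (letterCount_palLen_succ 0).2.1, h0]

lemma letterCount_c_palLen_add_three (k : ℕ) : letterCount .c (palLen (k + 3)) =
    letterCount .c (palLen (k + 2)) + letterCount .c (palLen (k + 1)) +
      letterCount .c (palLen k) + 1 := by
  have z0 := letterCount_c_palLen_lt_three (show 0 < 3 by omega)
  have z1 := letterCount_c_palLen_lt_three (show 1 < 3 by omega)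
  have z2 := letterCount_c_palLen_lt_three (show 2 < 3 by omega)
  have z3 := letterCount_c_palLen 0
  have z4 := letterCount_c_palLen 1
  have z5 := letterCount_c_palLen 2
  rw [show palLen 0 = 0 from rfl] at z3
  rw [show palLen 1 = 1 from rfl] at z4
  rw [show palLen 2 = 3 from rfl] at z5
  match k with
  | 0 => simp only [zero_add, Nat.reduceAdd] at *; omega
  | 1 => simp only [zero_add, Nat.reduceAdd] at *; omega
  | 2 => simp only [zero_add, Nat.reduceAdd] at *; omega
  | k + 3 =>
    have := palLen_add_three k
    simp only [letterCount_c_palLen (k + 2), letterCount_c_palLen (k + 1),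
      letterCount_c_palLen k, letterCount_c_palLen (k + 3)]
    omega

lemma D_palLen_add_three (m : ℕ) : D (palLen (m + 3)) = D (palLen (m + 2)) + D (palLen (m + 1)) +
    D (palLen m) + ∑ k ∈ Finset.range (m + 1), (palLen k + 1 - 2 * imgLen k .c) := by
  have hz := @letterCount_c_palLen_lt_three
  have e3 := D_palLen (m + 3)
  have e2 := D_palLen (m + 2)
  have e1 := D_palLen (m + 1)
  rw [Finset.sum_range_succ, Finset.sum_range_succ, Finset.sum_range_succ] at e3
  rw [Finset.sum_range_succ, Finset.sum_range_succ] at e2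
  rw [Finset.sum_range_succ] at e1
  rw [hz (by omega), hz (by omega), hz (by omega)] at e3
  rw [hz (by omega), hz (by omega)] at e2
  rw [hz (by omega)] at e1
  rw [e3, e2, e1, D_palLen m]
  simp only [zero_mul, add_zero, ← Finset.sum_add_distrib]
  refine Finset.sum_congr rfl fun k hk => ?_
  have hk' : k ≤ m := by simpa [Nat.lt_succ_iff] using hk
  rw [show m + 3 - k = m - k + 3 by omega, show m + 2 - k = m - k + 2 by omega,
    show m + 1 - k = m - k + 1 by omega, letterCount_c_palLen_add_three]
  ring

lemma D_palLen_diff_add_three (m : ℕ) :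
    (D (palLen (m + 4)) : ℤ) - D (palLen (m + 3)) =
      (D (palLen (m + 3)) - D (palLen (m + 2))) + (D (palLen (m + 2)) - D (palLen (m + 1))) +
      (D (palLen (m + 1)) - D (palLen m)) + (palLen (m + 1) + 1 - 2 * imgLen (m + 1) .c : ℕ) := by
  have h1 := D_palLen_add_three m
  have h2 := D_palLen_add_three (m + 1)
  rw [Finset.sum_range_succ] at h2
  rw [show m + 4 = m + 1 + 3 from rfl]
  rw [show m + 3 = m + 1 + 2 from rfl] at h1 ⊢
  rw [show m + 2 = m + 1 + 1 from rfl] at h1 ⊢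
  omega

lemma tribAux_add_two_gt (m : ℕ) : tribAux m + 1 ≤ tribAux (m + 2) := by
  match m with
  | 0 => decide
  | m + 1 =>
    change _ ≤ tribAux (m + 2) + tribAux (m + 1) + tribAux m
    have := tribAux_mono (show 1 ≤ m + 2 by omega)
    change 1 ≤ _ at this
    omega

lemma two_mul_imgLen_c_le {m : ℕ} (hm : 1 ≤ m) : 2 * imgLen m .c ≤ palLen m + 1 := by
  have h := two_mul_palLen m
  match m with
  | 1 => decide
  | m + 2 =>
    simp only [imgLen]
    have h1 := tribAux_add_two_gt m
    have e1 : tribAux (m + 2 + 3) = tribAux (m + 2 + 2) + tribAux (m + 2 + 1) + tribAux (m + 2) :=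
      rfl
    have e2 : tribAux (m + 2 + 2) = tribAux (m + 2 + 1) + tribAux (m + 2) + tribAux (m + 1) := rfl
    have e3 : tribAux (m + 2 + 1) = tribAux (m + 2) + tribAux (m + 1) + tribAux m := rfl
    omega

lemma D_palLen_eq_zero {m : ℕ} (hm : m < 7) : D (palLen m) = 0 := by
  rw [D_palLen]
  refine Finset.sum_eq_zero fun k hk => ?_
  rcases lt_or_ge k 4 with h | h
  · have : palLen k + 1 - 2 * imgLen k .c = 0 := by
      interval_cases k <;> rfl
    rw [this, mul_zero]
  · rw [letterCount_c_palLen_lt_three (by omega), zero_mul]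

lemma D_palLen_diff (n : ℕ) : (D (palLen (n + 3)) : ℚ) - D (palLen (n + 2)) =
    ((n : ℚ) + 3) / 22 * (7 * tribAux (n + 5) - 13 * tribAux (n + 4) + tribAux (n + 3)) +
    1 / 44 * (-41 * tribAux (n + 5) + 74 * tribAux (n + 4) - 7 * tribAux (n + 3)) + 1 / 4 := by
  induction n using Nat.strong_induction_on with
  | _ n ih =>
    match n with
    | 0 => norm_num [D_palLen_eq_zero, tribAux]
    | 1 => norm_num [D_palLen_eq_zero, tribAux]
    | 2 => norm_num [D_palLen_eq_zero, tribAux]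
    | n + 3 =>
      have h0 := ih n (by omega)
      have h1 := ih (n + 1) (by omega)
      have h2 := ih (n + 2) (by omega)
      have hrec := congrArg (Int.cast : ℤ → ℚ) (D_palLen_diff_add_three (n + 2))
      have hpal := congrArg (Nat.cast : ℕ → ℚ) (two_mul_palLen (n + 3))
      have hle := two_mul_imgLen_c_le (show 1 ≤ n + 3 by omega)
      have e8 : tribAux (n + 8) = tribAux (n + 7) + tribAux (n + 6) + tribAux (n + 5) := rfl
      have e7 : tribAux (n + 7) = tribAux (n + 6) + tribAux (n + 5) + tribAux (n + 4) := rfl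
      have e6 : tribAux (n + 6) = tribAux (n + 5) + tribAux (n + 4) + tribAux (n + 3) := rfl
      simp only [add_assoc, Nat.reduceAdd] at h0 h1 h2 hrec hpal hle ⊢
      push_cast [Nat.cast_sub hle] at h0 h1 h2 hrec hpal ⊢
      simp only [imgLen, add_assoc, Nat.reduceAdd] at hrec
      rw [hrec, h0, h1, h2]
      simp only [e8, e7, e6] at hpal ⊢
      push_cast at hpal ⊢
      linear_combination hpal / 2

lemma t_natCast_add (n : ℕ) (j : ℤ) (i : ℕ) (h : j + 2 = i) : t (n + j) = tribAux (n + i) := by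
  rw [t]
  congr 1
  omega

theorem repeated_cubes_block_sum (m : ℤ) (hm : 7 ≤ m) :
    (D ((t (m + 1) + t (m - 1) - 3) / 2) : ℚ) - (D ((t m + t (m - 2) - 3) / 2) : ℚ) =
      (m : ℚ) / 22 * (7 * (t m : ℚ) - 13 * (t (m - 1) : ℚ) + (t (m - 2) : ℚ)) +
      1 / 44 * (-41 * (t m : ℚ) + 74 * (t (m - 1) : ℚ) - 7 * (t (m - 2) : ℚ)) + 1 / 4 := by

  obtain ⟨n, rfl⟩ : ∃ n : ℕ, m = n + 3 := ⟨(m - 3).toNat, by omega⟩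
  have e6 : t (n + 3 + 1) = tribAux (n + 6) := by
    rw [add_assoc]
    exact t_natCast_add n _ 6 rfl
  have e5 : t (n + 3) = tribAux (n + 5) := t_natCast_add n 3 5 rfl
  have e4 : t (n + 3 - 1) = tribAux (n + 4) := by
    rw [add_sub_assoc]
    exact t_natCast_add n _ 4 rfl
  have e3 : t (n + 3 - 2) = tribAux (n + 3) := by
    rw [add_sub_assoc]
    exact t_natCast_add n _ 3 rfl
  have hp : (tribAux (n + 6) + tribAux (n + 4) - 3) / 2 = palLen (n + 3) := by
    have := two_mul_palLen (n + 3)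
    simp only [add_assoc, Nat.reduceAdd] at this
    omega
  have hp' : (tribAux (n + 5) + tribAux (n + 3) - 3) / 2 = palLen (n + 2) := by
    have := two_mul_palLen (n + 2)
    simp only [add_assoc, Nat.reduceAdd] at this
    omega
  rw [e6, e5, e4, e3, hp, hp', D_palLen_diff]
  push_cast
  ring
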